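/- arXiv:2602.23837 — 2 statements merged into one kernel-verified Lean document; each statement's English description precedes it below -/
import Mathlib

section
/- For any n ≥ m ≥ 3 and p1, p2 ∈ (0,1), the m-NED Markov chain is irreversible: taking α = 0^{n−2}10 (zeros in sites 1,…,n−2, a 1 at site n−1, a 0 at site n) and β = 0^{n−1}1 (zeros in sites 1,…,n−1, a 1 at site n), one has P(α → β) > 0 while P(β → α) = 0; hence the detailed balance condition π(α)P(α → β) = π(β)P(β → α) fails for the stationary distribution π. -/
open Finset

/-- Per-site transition factor `q_i(α, b)` of the m-NED: if the window
`(α_i, …, α_{i+m-1})` is `0^m` the site becomes `1` with probability `p1`;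
if it is `0^{m-1}1` it becomes `1` with probability `1 - p2`; otherwise it
becomes `0` with probability `1`. -/
noncomputable def nedQ (n m : ℕ) (p1 p2 : ℝ) (α : ZMod n → Bool) (i : ZMod n) (b : Bool) : ℝ :=
  if ∀ j : Fin m, α (i + (j.val : ZMod n)) = false then
    if b then p1 else 1 - p1
  else if (∀ j : Fin (m - 1), α (i + (j.val : ZMod n)) = false) ∧
      α (i + ((m - 1 : ℕ) : ZMod n)) = true then
    if b then 1 - p2 else p2
  else if b then 0 else 1

/-- Transition probability `P(α → β)` of the m-NED on the ring of `n` sites. -/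
noncomputable def nedP (n m : ℕ) [NeZero n] (p1 p2 : ℝ) (α β : ZMod n → Bool) : ℝ :=
  ∏ i : ZMod n, nedQ n m p1 p2 α i (β i)

/-- `N₁(β)`: the number of sites carrying the symbol `1`. -/
def nedN1 (n : ℕ) [NeZero n] (β : ZMod n → Bool) : ℕ :=
  (univ.filter fun i : ZMod n => β i = true).card

/-- `N_{10^r 1}(β)`: the number of occurrences of the subsequence `1 0^r 1`. -/
def nedN10r1 (n : ℕ) [NeZero n] (r : ℕ) (β : ZMod n → Bool) : ℕ :=
  (univ.filter fun i : ZMod n =>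
    β i = true ∧ (∀ j : Fin r, β (i + ((j.val + 1 : ℕ) : ZMod n)) = false) ∧
      β (i + ((r + 1 : ℕ) : ZMod n)) = true).card

/-- `N_{0^r 1}(β)`: the number of occurrences of the subsequence `0^r 1`. -/
def nedN0r1 (n : ℕ) [NeZero n] (r : ℕ) (β : ZMod n → Bool) : ℕ :=
  (univ.filter fun i : ZMod n =>
    (∀ j : Fin r, β (i + (j.val : ZMod n)) = false) ∧
      β (i + ((r : ℕ) : ZMod n)) = true).card

/-- The stationary weight
`W(β) = p1^{N₁(β)} (1-p1)^{∑_{r=1}^{m-2} r N_{10^r1}(β) + (m-1) N_{0^{m-1}1}(β)} p2^{-N_{0^{m-1}1}(β)}`. -/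
noncomputable def nedW (n m : ℕ) [NeZero n] (p1 p2 : ℝ) (β : ZMod n → Bool) : ℝ :=
  p1 ^ nedN1 n β *
    (1 - p1) ^ ((∑ r ∈ Finset.Icc 1 (m - 2), r * nedN10r1 n r β) +
      (m - 1) * nedN0r1 n (m - 1) β) / p2 ^ nedN0r1 n (m - 1) β

/-- The partition function `Z_{n,m} = ∑_{β ∈ Ω} W(β)`. -/
noncomputable def nedZ (n m : ℕ) [NeZero n] (p1 p2 : ℝ) : ℝ :=
  ∑ β : ZMod n → Bool, nedW n m p1 p2 β

/-- Integer binomial coefficient with the convention `C(-1,-1) = 1`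
(and value `0` when the lower index is otherwise negative). -/
def ichoose (a b : ℤ) : ℕ :=
  if a = -1 ∧ b = -1 then 1 else if 0 ≤ b then Nat.choose a.toNat b.toNat else 0

/-- The multinomial coefficient `k! / (x₁! ⋯ x_t! · N! · (k - N - ∑ x)!)`, written as the
product of successive binomial coefficients (hence `0` whenever `N + ∑ x > k`). -/
def multChain {t : ℕ} (k : ℕ) (x : Fin t → ℕ) (N : ℕ) : ℕ :=
  (∏ j : Fin t, Nat.choose (k - ∑ s ∈ univ.filter (fun s => s < j), x s) (x j)) *
    Nat.choose (k - ∑ s, x s) N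

/-- `𝒯_M`: the tuples `(x_1, …, x_{m-2}) ∈ {0,1,…,k}^{m-2}` with `∑_{s=1}^{m-2} s·x_s = M`. -/
def nedT (m k M : ℕ) : Finset (Fin (m - 2) → ℕ) :=
  (Fintype.piFinset fun _ : Fin (m - 2) => Finset.range (k + 1)).filter fun x =>
    ∑ s, (s.val + 1) * x s = M

/-- `𝒞_{n,k}`: the pairs `(M, N)` of nonnegative integers with
`M ∈ {0,…,n-k-m+1} ∪ {n-k}`, `(m-1)·N + M ≤ n-k`, and `N = 0 ↔ M = n-k`. -/
def nedC (n m k : ℕ) : Finset (ℕ × ℕ) :=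
  (Finset.range (n + 1) ×ˢ Finset.range (n + 1)).filter fun MN =>
    (MN.1 + (m - 1) ≤ n - k ∨ MN.1 = n - k) ∧
      MN.2 * (m - 1) + MN.1 ≤ n - k ∧ (MN.2 = 0 ↔ MN.1 = n - k)

/-- `|Pos_{a₁b₁,a₂b₂}|`: the number of sites `i` with `(α_i, α_{i+1}) = (a₁, b₁)` and
`(β_i, β_{i+1}) = (a₂, b₂)`. -/
def posCount (n : ℕ) [NeZero n] (α β : ZMod n → Bool) (a1 b1 a2 b2 : Bool) : ℕ :=
  (univ.filter fun i : ZMod n =>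
    α i = a1 ∧ α (i + 1) = b1 ∧ β i = a2 ∧ β (i + 1) = b2).card

/-- The explicit sequence `Z_0 = 2`,
`Z_n = 1 + ∑_{k=1}^n ∑_{j=0}^{n-k} (n/k)·C(k,j)·C(n-k-1,j-1)·p1^k·q2^j` for `n ≥ 1`,
with `q2 = (1-p1)/p2` and the convention `C(-1,-1) = 1`. -/
noncomputable def Zseq (p1 p2 : ℝ) (n : ℕ) : ℝ :=
  if n = 0 then 2
  else 1 + ∑ k ∈ Finset.Icc 1 n, ∑ j ∈ Finset.range (n - k + 1),
    (n : ℝ) / k * (Nat.choose k j : ℝ) * (ichoose ((n : ℤ) - k - 1) ((j : ℤ) - 1) : ℝ) *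
      p1 ^ k * ((1 - p1) / p2) ^ j

/-- The unnormalized density sequence `D_0 = 0`,
`D_n = ∑_{k=1}^n ∑_{j=0}^{n-k} C(k,j)·C(n-k-1,j-1)·p1^k·q2^j` for `n ≥ 1`. -/
noncomputable def Dseq (p1 p2 : ℝ) (n : ℕ) : ℝ :=
  if n = 0 then 0
  else ∑ k ∈ Finset.Icc 1 n, ∑ j ∈ Finset.range (n - k + 1),
    (Nat.choose k j : ℝ) * (ichoose ((n : ℤ) - k - 1) ((j : ℤ) - 1) : ℝ) *
      p1 ^ k * ((1 - p1) / p2) ^ j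

/-- The partition function of the 2-NED on a ring of `n ≥ 1` sites,
`Z_{n,2} = ∑_{β ∈ Ω} p1^{N₁(β)} ((1-p1)/p2)^{N_{01}(β)}` (with value `2` at `n = 0`). -/
noncomputable def Zpart2 (p1 p2 : ℝ) (n : ℕ) : ℝ :=
  if h : n = 0 then 2
  else
    haveI : NeZero n := ⟨h⟩
    ∑ β : ZMod n → Bool, p1 ^ nedN1 n β * ((1 - p1) / p2) ^ nedN0r1 n 1 β

lemma nedQ_false_pos (n m : ℕ) {p1 p2 : ℝ} (hp1 : p1 < 1) (hp2 : 0 < p2)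
    (α : ZMod n → Bool) (i : ZMod n) : 0 < nedQ n m p1 p2 α i false := by
  have h : 0 < 1 - p1 := sub_pos.2 hp1
  unfold nedQ
  split_ifs <;> simp_all

lemma nedQ_true_pos_of_forall_false {n m : ℕ} {p1 p2 : ℝ} (hp1 : 0 < p1) (hp2 : p2 < 1)
    {α : ZMod n → Bool} {i : ZMod n} (h : ∀ j : Fin (m - 1), α (i + (j.val : ZMod n)) = false) :
    0 < nedQ n m p1 p2 α i true := by
  unfold nedQ
  by_cases hlast : α (i + ((m - 1 : ℕ) : ZMod n)) = true
  · simp only [reduceIte]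
    split_ifs with _ hwin
    · exact hp1
    · exact sub_pos.2 hp2
    · exact absurd ⟨h, hlast⟩ hwin
  · rw [if_pos fun j : Fin m => ?_]
    · simpa using hp1
    · rcases (show j.val < m - 1 ∨ j.val = m - 1 by omega) with hj | hj
      · exact h ⟨j, hj⟩
      · simpa [hj] using hlast

lemma nedQ_true_eq_zero {n m : ℕ} (p1 p2 : ℝ) {α : ZMod n → Bool} {i : ZMod n} {j : ℕ}
    (hj : j < m - 1) (h : α (i + (j : ZMod n)) = true) : nedQ n m p1 p2 α i true = 0 := by
  unfold nedQ
  rw [if_neg fun H => ?_, if_neg fun H => ?_]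
  · simp
  · simpa [h] using H.1 ⟨j, hj⟩
  · simpa [h] using H ⟨j, by omega⟩

lemma nedW_pos (n m : ℕ) [NeZero n] {p1 p2 : ℝ} (hp1 : p1 ∈ Set.Ioo (0 : ℝ) 1) (hp2 : 0 < p2)
    (β : ZMod n → Bool) : 0 < nedW n m p1 p2 β :=
  div_pos (mul_pos (pow_pos hp1.1 _) (pow_pos (sub_pos.2 hp1.2) _)) (pow_pos hp2 _)

lemma nedZ_pos (n m : ℕ) [NeZero n] {p1 p2 : ℝ} (hp1 : p1 ∈ Set.Ioo (0 : ℝ) 1) (hp2 : 0 < p2) :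
    0 < nedZ n m p1 p2 :=
  Finset.sum_pos (fun β _ => nedW_pos n m hp1 hp2 β) univ_nonempty

/-- for `n ≥ m ≥ 3` and `p1, p2 ∈ (0,1)` the m-NED is irreversible:
with `α = 0^{n-2}10` and `β = 0^{n-1}1` one has `P(α → β) > 0` and `P(β → α) = 0`,
so detailed balance fails for the stationary distribution `π = W / Z_{n,m}`. -/
theorem ned_irreversible_of_three_le (n m : ℕ) [NeZero n] (hm : 3 ≤ m) (hmn : m ≤ n)
    (p1 p2 : ℝ) (hp1 : p1 ∈ Set.Ioo (0 : ℝ) 1) (hp2 : p2 ∈ Set.Ioo (0 : ℝ) 1) :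
    0 < nedP n m p1 p2 (fun i => decide (i = ((n - 1 : ℕ) : ZMod n)))
        (fun i => decide (i = ((n : ℕ) : ZMod n))) ∧
      nedP n m p1 p2 (fun i => decide (i = ((n : ℕ) : ZMod n)))
        (fun i => decide (i = ((n - 1 : ℕ) : ZMod n))) = 0 ∧
      ¬ (nedW n m p1 p2 (fun i => decide (i = ((n - 1 : ℕ) : ZMod n))) / nedZ n m p1 p2 *
            nedP n m p1 p2 (fun i => decide (i = ((n - 1 : ℕ) : ZMod n)))
              (fun i => decide (i = ((n : ℕ) : ZMod n))) =
          nedW n m p1 p2 (fun i => decide (i = ((n : ℕ) : ZMod n))) / nedZ n m p1 p2 *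
            nedP n m p1 p2 (fun i => decide (i = ((n : ℕ) : ZMod n)))
              (fun i => decide (i = ((n - 1 : ℕ) : ZMod n)))) := by
  have hpos : 0 < nedP n m p1 p2 (fun i => decide (i = ((n - 1 : ℕ) : ZMod n)))
      (fun i => decide (i = ((n : ℕ) : ZMod n))) := by
    refine Finset.prod_pos fun i _ => ?_
    by_cases hi : i = ((n : ℕ) : ZMod n)
    · simp only [hi, decide_true]
      refine nedQ_true_pos_of_forall_false hp1.1 hp2.2 fun j => ?_
      have hj := j.isLt
      rw [decide_eq_false_iff_not, ZMod.natCast_self, zero_add,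
        ZMod.natCast_eq_natCast_iff', Nat.mod_eq_of_lt (by omega), Nat.mod_eq_of_lt (by omega)]
      omega
    · simp only [hi, decide_false]
      exact nedQ_false_pos n m hp1.2 hp2.1 _ _
  have hzero : nedP n m p1 p2 (fun i => decide (i = ((n : ℕ) : ZMod n)))
      (fun i => decide (i = ((n - 1 : ℕ) : ZMod n))) = 0 := by
    refine Finset.prod_eq_zero (mem_univ ((n - 1 : ℕ) : ZMod n)) ?_
    simp only [decide_true]
    refine nedQ_true_eq_zero p1 p2 (j := 1) (by omega) ?_
    rw [decide_eq_true_iff, ← Nat.cast_add, Nat.sub_add_cancel (by omega)]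
  refine ⟨hpos, hzero, ?_⟩
  rw [hzero, mul_zero]
  exact (mul_pos (div_pos (nedW_pos n m hp1 hp2.1 _) (nedZ_pos n m hp1 hp2.1)) hpos).ne'
end

section
/- The partition function of the m-NED admits the explicit formula Z_{n,m} = 1 + ∑_{k=1}^{n} ∑_{(M,N) ∈ 𝒞_{n,k}} ∑_{(x_1,…,x_{m−2}) ∈ 𝒯_M} (n/k) · k!/(x_1!⋯x_{m−2}!·N!·(k−N−x_1−⋯−x_{m−2})!) · C(n−k−M−(m−2)N−1, N−1) · p1^k · (1−p1)^{M+(m−1)N} · p2^{−N}. -/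
open Finset

lemma multChain_cons {t : ℕ} (k x₀ : ℕ) (x : Fin t → ℕ) (N : ℕ) :
    multChain k (Fin.cons x₀ x : Fin (t + 1) → ℕ) N =
      k.choose x₀ * multChain (k - x₀) x N := by
  simp [multChain, Fin.prod_univ_succ, Fin.sum_univ_succ, Finset.sum_filter, Nat.sub_sub,
    mul_assoc]

lemma multChain_eq_zero_of_lt {t : ℕ} {k N : ℕ} (x : Fin t → ℕ) (h : k < N) :
    multChain k x N = 0 := by
  rw [multChain, Nat.choose_eq_zero_of_lt (by omega), mul_zero]

/-- The multinomial theorem in terms of `multChain`; the bounds of the summation box are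
arbitrary as long as they are at least the exponent. -/
lemma sum_multChain {R : Type*} [CommSemiring R] {t : ℕ} (a : Fin t → R) (b : R)
    {k K K' : ℕ} (hK : k ≤ K) (hK' : k ≤ K') :
    ∑ x ∈ Fintype.piFinset fun _ : Fin t => range (K + 1), ∑ N ∈ range (K' + 1),
      (multChain k x N : R) * (∏ s, a s ^ x s) * b ^ N = (1 + ∑ s, a s + b) ^ k := by
  induction t generalizing k with
  | zero =>
    have : (Fintype.piFinset fun _ : Fin 0 => range (K + 1)) = {Fin.elim0} := by
      ext x; simp [eq_iff_true_of_subsingleton]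
    rw [this, sum_singleton]
    simp only [univ_eq_empty, prod_empty, sum_empty, add_zero, mul_one]
    rw [add_comm 1 b, add_pow, ← sum_subset (range_subset_range.2 (Nat.succ_le_succ hK'))]
    · refine sum_congr rfl fun N _ => ?_
      simp [multChain, mul_comm]
    · intro N _ hN
      rw [multChain_eq_zero_of_lt _ (by simpa using hN)]
      simp
  | succ t ih =>
    have key : ∑ x ∈ Fintype.piFinset fun _ : Fin (t + 1) => range (K + 1),
        ∑ N ∈ range (K' + 1), (multChain k x N : R) * (∏ s, a s ^ x s) * b ^ N =
        ∑ x₀ ∈ range (K + 1), ∑ x ∈ Fintype.piFinset fun _ : Fin t => range (K + 1),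
          ∑ N ∈ range (K' + 1), (k.choose x₀ : R) * a 0 ^ x₀ *
            ((multChain (k - x₀) x N : R) * (∏ s, a s.succ ^ x s) * b ^ N) := by
      refine Eq.trans ?_ (sum_product' _ _ _)
      refine sum_bij' (fun x _ => (x 0, Fin.tail x)) (fun y _ => Fin.cons y.1 y.2) ?_ ?_ ?_ ?_ ?_
      · intro x hx
        simp only [Fintype.mem_piFinset, mem_product] at hx ⊢
        exact ⟨hx 0, fun i => hx i.succ⟩
      · intro y hy
        simp only [Fintype.mem_piFinset, mem_product] at hy ⊢
        exact Fin.cases hy.1 hy.2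
      · intro x _; simp
      · intro y _; simp
      · intro x _
        refine sum_congr rfl fun N _ => ?_
        conv_lhs => rw [← Fin.cons_self_tail x, multChain_cons]
        rw [Fin.prod_univ_succ]
        simp only [Fin.cons_zero, Fin.cons_succ]
        push_cast
        ring
    rw [key, Fin.sum_univ_succ,
      show 1 + (a 0 + ∑ s : Fin t, a s.succ) + b = a 0 + (1 + ∑ s : Fin t, a s.succ + b) by ring,
      add_pow, ← sum_subset (range_subset_range.2 (Nat.succ_le_succ hK))]
    · refine sum_congr rfl fun x₀ _ => ?_
      simp_rw [← mul_sum]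
      rw [ih _ (by omega) (by omega)]
      ring
    · intro x₀ _ hx
      rw [Nat.choose_eq_zero_of_lt (by simpa using hx)]
      simp

/-- The weight of a word read from left to right after a run of `g` zeros: every one contributes
`w r`, where `r` is the length of the run of zeros it ends. The weight is `0` unless the word has
exactly `k` ones and leaves no unfinished run of zeros at its end. -/
def gapEval (w : ℕ → ℝ) : List Bool → ℕ → ℕ → ℝ
  | [], k, g => if k = 0 ∧ g = 0 then 1 else 0
  | true :: _, 0, _ => 0
  | true :: l, k + 1, g => w g * gapEval w l k 0
  | false :: l, k, g => gapEval w l k (g + 1)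

lemma sum_bool_fin_succ (L : ℕ) (F : (Fin (L + 1) → Bool) → ℝ) :
    ∑ u, F u = ∑ u : Fin L → Bool, F (Fin.cons true u) + ∑ u : Fin L → Bool,
      F (Fin.cons false u) := by
  rw [← (Fin.consEquiv fun _ : Fin (L + 1) => Bool).sum_comp, Fintype.sum_prod_type]
  simp [Fin.consEquiv]

lemma sum_gapEval_zero (w : ℕ → ℝ) (L g : ℕ) :
    ∑ u : Fin L → Bool, gapEval w (List.ofFn u) 0 g = if L = 0 ∧ g = 0 then 1 else 0 := by
  induction L generalizing g with
  | zero => simp [gapEval]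
  | succ L ih => simp [sum_bool_fin_succ, List.ofFn_succ, gapEval, ih]

open PowerSeries in
lemma sum_gapEval_succ (w : ℕ → ℝ) (L k g : ℕ) :
    ∑ u : Fin L → Bool, gapEval w (List.ofFn u) (k + 1) g =
      coeff L (X * PowerSeries.mk (fun j => w (g + j)) * (X * PowerSeries.mk w) ^ k) := by
  induction L generalizing g k with
  | zero => simp [gapEval]
  | succ L ih =>
    have hmk : PowerSeries.mk (fun j => w (g + j)) =
        C (w g) + X * PowerSeries.mk (fun j => w (g + 1 + j)) := by
      ext j
      cases j with
      | zero => simp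
      | succ j => simp [coeff_succ_X_mul, coeff_succ_C, add_assoc, add_comm 1 j]
    rw [mul_assoc, coeff_succ_X_mul, hmk, add_mul, map_add, coeff_C_mul, ← ih]
    simp only [sum_bool_fin_succ, List.ofFn_succ, Fin.cons_zero, Fin.cons_succ, gapEval, ← mul_sum]
    congr 2
    cases k with
    | zero => simp [sum_gapEval_zero, coeff_one]
    | succ k => rw [ih, pow_succ']; simp

open PowerSeries in
lemma sum_gapEval (w : ℕ → ℝ) (n k : ℕ) (hk : 1 ≤ k) (hkn : k ≤ n) :
    ∑ u : Fin n → Bool, gapEval w (List.ofFn u) k 0 = coeff (n - k) (PowerSeries.mk w ^ k) := by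
  obtain ⟨k, rfl⟩ := Nat.exists_eq_add_of_le' hk
  have := sum_gapEval_succ w n k 0
  simp only [zero_add] at this
  rw [this, ← pow_succ', mul_pow, coeff_X_pow_mul', if_pos hkn]

/-- The length of the run of zeros of `b` just before position `i`, where a one is understood to
precede position `0`. -/
def gapBefore (b : ℕ → Bool) : ℕ → ℕ
  | 0 => 0
  | i + 1 => if b i then 0 else gapBefore b i + 1

lemma gapEval_ofFn (w : ℕ → ℝ) (b : ℕ → Bool) (L k s : ℕ) :
    gapEval w (List.ofFn fun i : Fin L => b (s + i)) k (gapBefore b s) =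
      if #{i ∈ range L | b (s + i)} = k ∧ gapBefore b (s + L) = 0 then
        ∏ i ∈ range L, if b (s + i) then w (gapBefore b (s + i)) else 1 else 0 := by
  induction L generalizing k s with
  | zero => simp [gapEval, eq_comm (a := 0) (b := k)]
  | succ L ih =>
    have e : ∀ i, s + 1 + i = s + (i + 1) := by intro i; omega
    have ih' := fun k => ih k (s + 1)
    simp only [e] at ih'
    rw [prod_range_succ', card_filter, sum_range_succ', ← card_filter]
    simp only [List.ofFn_succ, Fin.val_zero, Fin.val_succ, add_zero]
    cases hb : b s with
    | true =>
      have hg : gapBefore b (s + 1) = 0 := by rw [gapBefore, if_pos hb]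
      cases k with
      | zero => simp [gapEval]
      | succ k =>
        rw [gapEval, ← hg, ih']
        simp only [if_true, add_left_inj, hg]
        split_ifs <;> ring
    | false =>
      have hg : gapBefore b s + 1 = gapBefore b (s + 1) := by
        rw [gapBefore, if_neg (by simp [hb])]
      rw [gapEval, hg, ih']
      simp

/-- The weight contributed by a one preceded by a run of exactly `g` zeros. -/
noncomputable def runWeight (m : ℕ) (p1 p2 : ℝ) (g : ℕ) : ℝ :=
  p1 * (1 - p1) ^ min g (m - 1) / p2 ^ (if m - 1 ≤ g then 1 else 0)

lemma sum_zmod_eq_sum_range {M : Type*} [AddCommMonoid M] (n : ℕ) [NeZero n] (F : ZMod n → M)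
    (c : ZMod n) : ∑ z, F z = ∑ i ∈ range n, F (i + c) := by
  rw [← Equiv.sum_comp (Equiv.addRight c) F]
  refine sum_nbij' ZMod.val (fun i => (i : ZMod n)) ?_ ?_ ?_ ?_ ?_
  · intro z _; simpa using ZMod.val_lt z
  · intro i _; simp
  · intro z _; simp
  · intro i hi; exact ZMod.val_cast_of_lt (by simpa using hi)
  · intro z _; simp

lemma card_zmod_filter (n : ℕ) [NeZero n] (Q : ZMod n → Prop) [DecidablePred Q] (c : ZMod n) :
    #{z | Q z} = #{i ∈ range n | Q ((i : ℕ) + c)} := by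
  rw [card_filter, card_filter, sum_zmod_eq_sum_range n _ c]

lemma le_gapBefore_iff {n : ℕ} {β : ZMod n → Bool} (h0 : β 0 = true) (i r : ℕ) :
    r ≤ gapBefore (fun i => β ((i + 1 : ℕ) : ZMod n)) i ↔
      ∀ j < r, β ((i : ZMod n) - (j : ZMod n)) = false := by
  induction i generalizing r with
  | zero =>
    cases r with
    | zero => simp
    | succ r => simpa [gapBefore] using ⟨0, by simp, by simpa using h0⟩
  | succ i ih =>
    cases r with
    | zero => simp
    | succ r =>
      rw [Nat.forall_lt_succ_left, gapBefore]
      have e : ∀ j : ℕ, ((i + 1 : ℕ) : ZMod n) - ((j + 1 : ℕ) : ZMod n) = i - j := by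
        intro j; push_cast; ring
      simp only [e, ← ih, Nat.cast_zero, sub_zero]
      cases β ((i + 1 : ℕ) : ZMod n) <;> simp

lemma forall_fin_iff_le_gapBefore {n : ℕ} {β : ZMod n → Bool} (h0 : β 0 = true) (i r : ℕ) :
    (∀ j : Fin r, β ((i : ZMod n) + (1 - (r : ZMod n)) + (j.val : ZMod n)) = false) ↔
      r ≤ gapBefore (fun i => β ((i + 1 : ℕ) : ZMod n)) i := by
  rw [le_gapBefore_iff h0,
    ← Fin.forall_iff (p := fun j => β ((i : ZMod n) - (j.val : ZMod n)) = false), ← Fin.revPerm.forall_congr_right]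
  refine forall_congr' fun j => ?_
  have : ((Fin.rev j).val : ZMod n) = r - (j.val + 1) := by
    rw [Fin.val_rev, Nat.cast_sub j.isLt]; push_cast; ring
  rw [Fin.revPerm_apply, this]
  ring_nf

lemma nedN0r1_eq {n : ℕ} [NeZero n] {β : ZMod n → Bool} (h0 : β 0 = true) (r : ℕ) :
    nedN0r1 n r β = #{i ∈ range n | β ((i + 1 : ℕ) : ZMod n) = true ∧
      r ≤ gapBefore (fun i => β ((i + 1 : ℕ) : ZMod n)) i} := by
  rw [nedN0r1, card_zmod_filter n _ (1 - (r : ZMod n))]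
  congr 1
  refine filter_congr fun i _ => ?_
  rw [forall_fin_iff_le_gapBefore h0, and_comm]
  push_cast
  ring_nf

lemma nedN10r1_eq {n : ℕ} [NeZero n] {β : ZMod n → Bool} (h0 : β 0 = true) (r : ℕ) :
    nedN10r1 n r β = #{i ∈ range n | β ((i + 1 : ℕ) : ZMod n) = true ∧
      gapBefore (fun i => β ((i + 1 : ℕ) : ZMod n)) i = r} := by
  rw [nedN10r1, card_zmod_filter n _ (-(r : ZMod n))]
  congr 1
  refine filter_congr fun i _ => ?_
  have e₁ : ∀ j : Fin r, (i : ZMod n) + -(r : ZMod n) + ((j.val + 1 : ℕ) : ZMod n) =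
      i + (1 - (r : ZMod n)) + (j.val : ZMod n) := by intro j; push_cast; ring
  have e₂ : (i : ZMod n) + -(r : ZMod n) + ((r + 1 : ℕ) : ZMod n) = ((i + 1 : ℕ) : ZMod n) := by
    push_cast; ring
  simp only [e₁, e₂]
  rw [forall_fin_iff_le_gapBefore h0]
  have h₁ := le_gapBefore_iff h0 i r
  have h₂ := le_gapBefore_iff h0 i (r + 1)
  rw [Nat.forall_lt_succ_right, ← h₁, ← sub_eq_add_neg] at *
  cases h : β ((i : ZMod n) - r) <;> simp only [h] at h₂ ⊢ <;> grind

lemma nedN1_eq {n : ℕ} [NeZero n] (β : ZMod n → Bool) :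
    nedN1 n β = #{i ∈ range n | β ((i + 1 : ℕ) : ZMod n) = true} := by
  rw [nedN1, card_zmod_filter n _ 1]
  simp

lemma nedW_eq_prod {n : ℕ} [NeZero n] {m : ℕ} (p1 p2 : ℝ) {β : ZMod n → Bool} (hm : 2 ≤ m)
    (h0 : β 0 = true) :
    nedW n m p1 p2 β = ∏ i ∈ range n, if β ((i + 1 : ℕ) : ZMod n) then
      runWeight m p1 p2 (gapBefore (fun i => β ((i + 1 : ℕ) : ZMod n)) i) else 1 := by
  rw [nedW, nedN0r1_eq h0, nedN1_eq, ← prod_filter]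
  simp only [nedN10r1_eq h0, runWeight, ← filter_filter]
  set S := {i ∈ range n | β ((i + 1 : ℕ) : ZMod n) = true}
  set G := gapBefore (fun i => β ((i + 1 : ℕ) : ZMod n))
  rw [prod_div_distrib, prod_mul_distrib, prod_const, prod_pow_eq_pow_sum, prod_pow_eq_pow_sum,
    ← card_filter]
  congr 3
  simp only [card_filter, mul_sum]
  rw [sum_comm, ← sum_add_distrib]
  refine sum_congr rfl fun i _ => ?_
  simp only [mul_ite, mul_one, mul_zero, sum_ite_eq, mem_Icc]
  split_ifs <;> omega

lemma sum_nedW_eq_coeff {n : ℕ} [NeZero n] {m : ℕ} (p1 p2 : ℝ) (hm : 2 ≤ m) {k : ℕ} (hk : 1 ≤ k)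
    (hkn : k ≤ n) :
    ∑ β : ZMod n → Bool with β 0 = true ∧ nedN1 n β = k, nedW n m p1 p2 β =
      PowerSeries.coeff (n - k) (PowerSeries.mk (runWeight m p1 p2) ^ k) := by
  have hn : 0 < n := NeZero.pos n
  rw [← sum_gapEval _ n k hk hkn, sum_filter]
  let e : Fin n ≃ ZMod n :=
    { toFun := fun i => ((i.val + 1 : ℕ) : ZMod n)
      invFun := fun z => ⟨(z - 1).val, ZMod.val_lt _⟩
      left_inv := fun i => by
        ext
        simp [ZMod.val_cast_of_lt i.isLt]
      right_inv := fun z => by simp }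
  refine Fintype.sum_equiv (e.symm.arrowCongr (Equiv.refl Bool)) _ _ fun β => ?_
  have hE : (e.symm.arrowCongr (Equiv.refl Bool)) β =
      fun i : Fin n => (fun i : ℕ => β ((i + 1 : ℕ) : ZMod n)) (0 + i.val) := by
    ext i; simp [e]
  have hE' := gapEval_ofFn (runWeight m p1 p2) (fun i : ℕ => β ((i + 1 : ℕ) : ZMod n)) n k 0
  rw [hE]
  rw [show gapBefore (fun i : ℕ => β ((i + 1 : ℕ) : ZMod n)) 0 = 0 from rfl] at hE'
  rw [hE']
  have hlast : gapBefore (fun i : ℕ => β ((i + 1 : ℕ) : ZMod n)) n = 0 ↔ β 0 = true := by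
    obtain ⟨n', rfl⟩ := Nat.exists_eq_succ_of_ne_zero hn.ne'
    rw [gapBefore]
    simp only [CharP.cast_eq_zero]
    cases β 0 <;> simp
  simp only [zero_add, hlast, nedN1_eq, and_comm (a := β 0 = true)]
  split_ifs with h
  · exact nedW_eq_prod p1 p2 hm h.2
  · rfl

open PowerSeries in
lemma mk_runWeight_eq {m : ℕ} (hm : 2 ≤ m) (p1 p2 : ℝ) :
    PowerSeries.mk (runWeight m p1 p2) =
      C p1 * (1 + ∑ s : Fin (m - 2), C ((1 - p1) ^ (s.val + 1)) * X ^ (s.val + 1) +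
        C ((1 - p1) ^ (m - 1) / p2) * X ^ (m - 1) * PowerSeries.mk 1) := by
  ext j
  rw [coeff_mk, coeff_C_mul, map_add, map_add, mul_assoc (C _) (X ^ (m - 1)), coeff_C_mul,
    coeff_X_pow_mul', map_sum]
  simp only [coeff_C_mul, coeff_X_pow, coeff_one, coeff_mk, Pi.one_apply, mul_ite, mul_one,
    mul_zero, runWeight]
  rw [Fin.sum_univ_eq_sum_range (fun s => if j = s + 1 then (1 - p1) ^ (s + 1) else 0)]
  cases j with
  | zero => simp [show m - 1 ≠ 0 by omega]
  | succ j =>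
    simp only [add_left_inj, sum_ite_eq, mem_range, Nat.succ_ne_zero, if_false, zero_add]
    by_cases h : m - 1 ≤ j + 1
    · rw [min_eq_right h, if_pos h, if_pos h, if_neg (by omega)]
      ring
    · rw [min_eq_left (by omega), if_neg h, if_neg h, if_pos (by omega)]
      ring

open PowerSeries in
lemma coeff_mk_runWeight_pow {m : ℕ} (hm : 2 ≤ m) (p1 p2 : ℝ) (L : ℕ) {k K : ℕ} (hK : k ≤ K) :
    coeff L (PowerSeries.mk (runWeight m p1 p2) ^ k) =
      ∑ x ∈ Fintype.piFinset fun _ : Fin (m - 2) => range (k + 1), ∑ N ∈ range (K + 1),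
        (multChain k x N : ℝ) * p1 ^ k *
          (1 - p1) ^ (∑ s, (s.val + 1) * x s + (m - 1) * N) / p2 ^ N *
          coeff L ((X : ℝ⟦X⟧) ^ (∑ s, (s.val + 1) * x s + (m - 1) * N) * PowerSeries.mk 1 ^ N) := by
  rw [mk_runWeight_eq hm, mul_pow, ← sum_multChain _ _ le_rfl hK, ← map_pow, coeff_C_mul, map_sum,
    mul_sum]
  refine sum_congr rfl fun x _ => ?_
  rw [map_sum, mul_sum]
  refine sum_congr rfl fun N _ => ?_
  simp only [mul_pow, prod_mul_distrib, ← pow_mul, prod_pow_eq_pow_sum, ← map_pow, ← map_prod]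
  have e : ∀ c : ℕ, (c : ℝ⟦X⟧) = C (c : ℝ) := fun c => by simp
  rw [e, pow_add X, pow_add, div_pow, ← pow_mul]
  rw [show ∀ a b c : ℝ, ∀ Y Z V : ℝ⟦X⟧, C a * (C b * Y) * (C c * Z * V) =
    C (a * b * c) * (Y * Z * V) by intros; simp only [map_mul]; ring, coeff_C_mul]
  ring

open PowerSeries in
lemma coeff_X_pow_mul_mk_one_pow {m : ℕ} (hm : 2 ≤ m) (L M N : ℕ) :
    coeff L ((X : ℝ⟦X⟧) ^ (M + (m - 1) * N) * PowerSeries.mk 1 ^ N) =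
      if (M + (m - 1) ≤ L ∨ M = L) ∧ N * (m - 1) + M ≤ L ∧ (N = 0 ↔ M = L) then
        (ichoose ((L : ℤ) - M - ((m : ℤ) - 2) * N - 1) ((N : ℤ) - 1) : ℝ) else 0 := by
  obtain ⟨m, rfl⟩ := Nat.exists_eq_add_of_le' hm
  rw [coeff_X_pow_mul']
  cases N with
  | zero =>
    simp only [pow_zero, coeff_one, mul_zero, add_zero, zero_mul, zero_add, true_iff]
    rcases eq_or_ne M L with rfl | h
    · simp [ichoose]
    · rw [if_neg (by tauto : ¬ ((_ ∨ _) ∧ _ ∧ _))]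
      split_ifs <;> first | rfl | omega
  | succ N =>
    rw [mk_one_pow_eq_mk_choose_add, coeff_mk]
    have e : M + (m + 2 - 1) * (N + 1) = M + (m + 1) + (m + 1) * N := by
      rw [show m + 2 - 1 = m + 1 by omega]; ring
    have e' : (N + 1) * (m + 2 - 1) + M = M + (m + 1) + (m + 1) * N := by
      rw [show m + 2 - 1 = m + 1 by omega]; ring
    rw [e, e']
    by_cases h : M + (m + 1) + (m + 1) * N ≤ L
    · have hle : M + (m + 1) ≤ L := le_trans (Nat.le_add_right _ _) h
      rw [if_pos h, if_pos ⟨Or.inl (by omega), h, by omega⟩]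
      obtain ⟨d, rfl⟩ := Nat.exists_eq_add_of_le h
      have e₁ : ((M + (m + 1) + (m + 1) * N + d : ℕ) : ℤ) - M - (((m + 2 : ℕ) : ℤ) - 2) *
          ((N + 1 : ℕ) : ℤ) - 1 = ((N + d : ℕ) : ℤ) := by push_cast; ring
      have e₂ : ((N + 1 : ℕ) : ℤ) - 1 = (N : ℤ) := by push_cast; ring
      rw [e₁, e₂, ichoose, if_neg (by omega), if_pos (by omega), Int.toNat_natCast,
        Int.toNat_natCast, Nat.add_sub_cancel_left]
    · rw [if_neg h, if_neg (by tauto)]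

lemma coeff_mk_runWeight_pow_eq_sum_nedC {n m : ℕ} (hm : 2 ≤ m) (p1 p2 : ℝ) {k : ℕ}
    (hkn : k ≤ n) :
    PowerSeries.coeff (n - k) (PowerSeries.mk (runWeight m p1 p2) ^ k) =
      ∑ MN ∈ nedC n m k, ∑ x ∈ nedT m k MN.1, (multChain k x MN.2 : ℝ) *
          (ichoose ((n : ℤ) - k - MN.1 - ((m : ℤ) - 2) * MN.2 - 1) ((MN.2 : ℤ) - 1) : ℝ) *
          p1 ^ k * (1 - p1) ^ (MN.1 + (m - 1) * MN.2) / p2 ^ MN.2 := by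
  rw [coeff_mk_runWeight_pow hm p1 p2 (n - k) hkn, nedC, sum_filter, sum_product_right, sum_comm]
  refine sum_congr rfl fun N _ => ?_
  simp only [nedT, sum_filter]
  have hswap : ∀ F : ℕ → (Fin (m - 2) → ℕ) → ℝ, ∀ P : ℕ → Prop, ∀ _ : DecidablePred P,
      ∑ M ∈ range (n + 1), (if P M then
        ∑ x ∈ Fintype.piFinset fun _ : Fin (m - 2) => range (k + 1),
          if ∑ s, (s.val + 1) * x s = M then F M x else 0 else 0) =
      ∑ x ∈ Fintype.piFinset fun _ : Fin (m - 2) => range (k + 1),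
        if ∑ s, (s.val + 1) * x s ≤ n ∧ P (∑ s, (s.val + 1) * x s) then
          F (∑ s, (s.val + 1) * x s) x else 0 := by
    intro F P _
    have hpush : ∀ M, (if P M then
        ∑ x ∈ Fintype.piFinset fun _ : Fin (m - 2) => range (k + 1),
          if ∑ s, (s.val + 1) * x s = M then F M x else 0 else 0) =
        ∑ x ∈ Fintype.piFinset fun _ : Fin (m - 2) => range (k + 1),
          if ∑ s, (s.val + 1) * x s = M then (if P M then F M x else 0) else 0 := by
      intro M
      split_ifs <;> simp
    simp only [hpush]
    rw [sum_comm]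
    refine sum_congr rfl fun x _ => ?_
    rw [sum_ite_eq, ite_and]
    simp only [mem_range, Nat.lt_succ_iff]
  rw [hswap]
  refine sum_congr rfl fun x _ => ?_
  rw [coeff_X_pow_mul_mk_one_pow hm, Nat.cast_sub hkn]
  simp only [mul_ite, mul_zero]
  refine if_congr ?_ (by ring) rfl
  constructor
  · intro h; exact ⟨by omega, h⟩
  · exact fun h => h.2

lemma nedN1_shift {n : ℕ} [NeZero n] (β : ZMod n → Bool) (c : ZMod n) :
    nedN1 n (fun z => β (z + c)) = nedN1 n β := by
  refine card_equiv (Equiv.addRight c) fun i => ?_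
  simp

lemma nedN10r1_shift {n : ℕ} [NeZero n] (r : ℕ) (β : ZMod n → Bool) (c : ZMod n) :
    nedN10r1 n r (fun z => β (z + c)) = nedN10r1 n r β := by
  refine card_equiv (Equiv.addRight c) fun i => ?_
  simp only [mem_filter, mem_univ, true_and, Equiv.coe_addRight, add_right_comm i c]

lemma nedN0r1_shift {n : ℕ} [NeZero n] (r : ℕ) (β : ZMod n → Bool) (c : ZMod n) :
    nedN0r1 n r (fun z => β (z + c)) = nedN0r1 n r β := by
  refine card_equiv (Equiv.addRight c) fun i => ?_
  simp only [mem_filter, mem_univ, true_and, Equiv.coe_addRight, add_right_comm i c]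

lemma nedW_shift {n m : ℕ} [NeZero n] (p1 p2 : ℝ) (β : ZMod n → Bool) (c : ZMod n) :
    nedW n m p1 p2 (fun z => β (z + c)) = nedW n m p1 p2 β := by
  simp only [nedW, nedN1_shift, nedN10r1_shift, nedN0r1_shift]

lemma mul_sum_nedW_eq {n m : ℕ} [NeZero n] (p1 p2 : ℝ) (k : ℕ) :
    (k : ℝ) * ∑ β : ZMod n → Bool with nedN1 n β = k, nedW n m p1 p2 β =
      n * ∑ β : ZMod n → Bool with β 0 = true ∧ nedN1 n β = k, nedW n m p1 p2 β := by
  have hcount : (k : ℝ) * ∑ β : ZMod n → Bool with nedN1 n β = k, nedW n m p1 p2 β =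
      ∑ i : ZMod n, ∑ β : ZMod n → Bool with β i = true ∧ nedN1 n β = k, nedW n m p1 p2 β := by
    simp only [mul_sum, sum_filter]
    rw [sum_comm]
    refine sum_congr rfl fun β _ => ?_
    by_cases h : nedN1 n β = k
    · simp only [h, and_true, if_true]
      rw [← sum_filter, sum_const, nsmul_eq_mul, ← h, nedN1]
    · simp [h]
  rw [hcount, sum_congr rfl (g := fun _ => ∑ β : ZMod n → Bool with
    β 0 = true ∧ nedN1 n β = k, nedW n m p1 p2 β), sum_const, card_univ, ZMod.card, nsmul_eq_mul]
  intro i _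
  simp only [sum_filter]
  refine Fintype.sum_equiv ((Equiv.addRight (-i)).arrowCongr (Equiv.refl Bool)) _ _ fun β => ?_
  have hE : ((Equiv.addRight (-i)).arrowCongr (Equiv.refl Bool)) β = fun z => β (z + i) := by
    ext z; simp
  rw [hE, nedN1_shift, nedW_shift]
  simp only [zero_add]

lemma nedW_of_nedN1_eq_zero {n m : ℕ} [NeZero n] (p1 p2 : ℝ) {β : ZMod n → Bool}
    (h : nedN1 n β = 0) : nedW n m p1 p2 β = 1 := by
  have hβ : ∀ i, β i = false := by
    intro i
    simpa using filter_eq_empty_iff.1 (card_eq_zero.1 h) (mem_univ i)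
  simp [nedW, nedN1, nedN10r1, nedN0r1, hβ]

lemma nedN1_le {n : ℕ} [NeZero n] (β : ZMod n → Bool) : nedN1 n β ≤ n :=
  (card_filter_le _ _).trans_eq (by rw [card_univ, ZMod.card])

lemma sum_nedW_nedN1_eq_zero {n m : ℕ} [NeZero n] (p1 p2 : ℝ) :
    ∑ β : ZMod n → Bool with nedN1 n β = 0, nedW n m p1 p2 β = 1 := by
  rw [sum_congr rfl fun β hβ => nedW_of_nedN1_eq_zero p1 p2 (mem_filter.1 hβ).2, sum_const]
  have : ({β : ZMod n → Bool | nedN1 n β = 0} : Finset _) = {fun _ => false} := by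
    ext β
    simp [nedN1, filter_eq_empty_iff, funext_iff]
  simp [this]

/-- the explicit formula for the partition function `Z_{n,m}`. -/
theorem ned_partition_function_formula (n m : ℕ) [NeZero n] (hm : 2 ≤ m) (hmn : m ≤ n)
    (p1 p2 : ℝ) (hp1 : p1 ∈ Set.Ioo (0 : ℝ) 1) (hp2 : p2 ∈ Set.Ioc (0 : ℝ) 1) :
    nedZ n m p1 p2 =
      1 + ∑ k ∈ Finset.Icc 1 n, ∑ MN ∈ nedC n m k, ∑ x ∈ nedT m k MN.1,
        (n : ℝ) / k * (multChain k x MN.2 : ℝ) *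
          (ichoose ((n : ℤ) - k - MN.1 - ((m : ℤ) - 2) * MN.2 - 1) ((MN.2 : ℤ) - 1) : ℝ) *
          p1 ^ k * (1 - p1) ^ (MN.1 + (m - 1) * MN.2) / p2 ^ MN.2 := by
  have hsplit : nedZ n m p1 p2 = ∑ k ∈ range (n + 1),
      ∑ β : ZMod n → Bool with nedN1 n β = k, nedW n m p1 p2 β :=
    (sum_fiberwise_of_maps_to (fun β _ => mem_range.2 (Nat.lt_succ_of_le (nedN1_le β))) _).symm
  rw [hsplit, range_eq_Ico, sum_eq_sum_Ico_succ_bot (Nat.succ_pos n), sum_nedW_nedN1_eq_zero]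
  congr 1
  refine sum_congr rfl fun k hk => ?_
  obtain ⟨hk1, hkn⟩ := mem_Icc.1 hk
  have hk0 : (k : ℝ) ≠ 0 := by positivity
  have h := mul_sum_nedW_eq (n := n) (m := m) p1 p2 k
  rw [sum_nedW_eq_coeff p1 p2 hm hk1 hkn, coeff_mk_runWeight_pow_eq_sum_nedC hm p1 p2 hkn,
    mul_comm, ← eq_div_iff hk0, mul_div_right_comm] at h
  rw [h]
  simp only [mul_sum]
  refine sum_congr rfl fun MN _ => sum_congr rfl fun x _ => ?_
  ring
end
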